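/- Let k be a positive integer, let a_0, b_0 > 0 and a_1, …, a_k, b_1, …, b_k > 0, set a(x) = a_0·∏_{j=1}^k (x + a_j) and b(x) = b_0·∏_{j=1}^k (x + b_j) for x ≥ 0, and let {c(m)}_{m ∈ ℤ₊} be a sequence of positive real numbers. Assume (A1): b_1 ≤ a_1 ≤ b_2 ≤ a_2 ≤ … ≤ b_k ≤ a_k, and (A2): the sequence {c(m)/a(m)}_{m ∈ ℤ₊} is completely monotone. Then the double net {c(m)/(b(m) + a(m)·n)}_{m,n ∈ ℤ₊} is joint completely monotone. -/

import Mathlib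

noncomputable section

/-- Forward difference operator for sequences. -/
def dSeq (s : ℕ → ℝ) : ℕ → ℝ := fun m => s (m + 1) - s m

/-- A sequence is completely monotone. -/
def CompMono (s : ℕ → ℝ) : Prop := ∀ k m : ℕ, 0 ≤ (-1 : ℝ) ^ k * dSeq^[k] s m

/-- A completely monotone sequence is minimal. -/
def MinCompMono (s : ℕ → ℝ) : Prop :=
  CompMono s ∧ ∀ ε : ℝ, 0 < ε → ¬ CompMono (fun k => s k - if k = 0 then ε else 0)

/-- First forward difference operator for double nets. -/
def d1 (a : ℕ → ℕ → ℝ) : ℕ → ℕ → ℝ := fun m n => a (m + 1) n - a m n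

/-- Second forward difference operator for double nets. -/
def d2 (a : ℕ → ℕ → ℝ) : ℕ → ℕ → ℝ := fun m n => a m (n + 1) - a m n

/-- A double net is joint completely monotone. -/
def JointCompMono (a : ℕ → ℕ → ℝ) : Prop :=
  ∀ β₁ β₂ m n : ℕ, 0 ≤ (-1 : ℝ) ^ (β₁ + β₂) * d1^[β₁] (d2^[β₂] a) m n

/-- A joint completely monotone double net is minimal. -/
def MinJointCompMono (a : ℕ → ℕ → ℝ) : Prop :=
  JointCompMono a ∧
    (∀ ε : ℝ, 0 < ε → ¬ CompMono (fun k => a k 0 - if k = 0 then ε else 0)) ∧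
    (∀ ε : ℝ, 0 < ε → ¬ CompMono (fun k => a 0 k - if k = 0 then ε else 0))

/-- Complete monotonicity up to order `N`. -/
def CompMonoUpTo : ℕ → (ℕ → ℝ) → Prop
  | 0, s => ∀ m, 0 ≤ s m
  | N + 1, s => (∀ m, 0 ≤ s m) ∧ CompMonoUpTo N (fun m => s m - s (m + 1))

theorem dSeq_iterate_const_mul (t : ℝ) (s : ℕ → ℝ) (k m : ℕ) :
    dSeq^[k] (fun i => t * s i) m = t * dSeq^[k] s m := by
  induction k generalizing m with
  | zero => rfl
  | succ k ih =>
    simp only [Function.iterate_succ_apply', dSeq] at ih ⊢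
    rw [ih, ih]; ring

theorem neg_one_pow_succ_mul_dSeq_iterate (s : ℕ → ℝ) (k m : ℕ) :
    (-1 : ℝ) ^ (k + 1) * dSeq^[k + 1] s m =
      (-1 : ℝ) ^ k * dSeq^[k] (fun i => s i - s (i + 1)) m := by
  have h : (fun i => s i - s (i + 1)) = fun i => (-1) * dSeq s i := by
    funext i; simp only [dSeq]; ring
  rw [h, dSeq_iterate_const_mul, Function.iterate_succ_apply]
  ring

theorem CompMono.sub_shift {s : ℕ → ℝ} (h : CompMono s) :
    CompMono (fun i => s i - s (i + 1)) := fun k m => by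
  rw [← neg_one_pow_succ_mul_dSeq_iterate]
  exact h (k + 1) m

theorem CompMono.nonneg {s : ℕ → ℝ} (h : CompMono s) (m : ℕ) : 0 ≤ s m := by
  simpa using h 0 m

theorem compMono_iff {s : ℕ → ℝ} : CompMono s ↔ ∀ N, CompMonoUpTo N s := by
  constructor
  · intro h N
    induction N generalizing s with
    | zero => exact h.nonneg
    | succ N ih => exact ⟨h.nonneg, ih h.sub_shift⟩
  · intro h k
    induction k generalizing s with
    | zero => intro m; simpa using h 0 m
    | succ k ih =>
      intro m
      rw [neg_one_pow_succ_mul_dSeq_iterate]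
      exact ih (fun N => (h (N + 1)).2) m

namespace CompMonoUpTo

variable {N : ℕ} {s t : ℕ → ℝ}

theorem nonneg (h : CompMonoUpTo N s) (m : ℕ) : 0 ≤ s m := by
  cases N with
  | zero => exact h m
  | succ N => exact h.1 m

theorem of_succ (h : CompMonoUpTo (N + 1) s) : CompMonoUpTo N s := by
  induction N generalizing s with
  | zero => exact h.1
  | succ N ih => exact ⟨h.1, ih h.2⟩

theorem shift (h : CompMonoUpTo N s) : CompMonoUpTo N (fun m => s (m + 1)) := by
  induction N generalizing s with
  | zero => exact fun m => h (m + 1)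
  | succ N ih => exact ⟨fun m => h.1 (m + 1), ih h.2⟩

theorem add (hs : CompMonoUpTo N s) (ht : CompMonoUpTo N t) :
    CompMonoUpTo N (fun m => s m + t m) := by
  induction N generalizing s t with
  | zero => exact fun m => add_nonneg (hs m) (ht m)
  | succ N ih =>
    refine ⟨fun m => add_nonneg (hs.1 m) (ht.1 m), ?_⟩
    convert ih hs.2 ht.2 using 2 with m
    ring

theorem mul (hs : CompMonoUpTo N s) (ht : CompMonoUpTo N t) :
    CompMonoUpTo N (fun m => s m * t m) := by
  induction N generalizing s t with
  | zero => exact fun m => mul_nonneg (hs m) (ht m)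
  | succ N ih =>
    refine ⟨fun m => mul_nonneg (hs.1 m) (ht.1 m), ?_⟩
    convert (ih hs.2 ht.of_succ).add (ih hs.of_succ.shift ht.2) using 2 with m
    ring

theorem inv (hs : ∀ m, 0 < s m) (h : CompMonoUpTo N (fun m => s (m + 1) - s m)) :
    CompMonoUpTo N (fun m => (s m)⁻¹) := by
  induction N with
  | zero => exact fun m => (inv_pos.2 (hs m)).le
  | succ N ih =>
    refine ⟨fun m => (inv_pos.2 (hs m)).le, ?_⟩
    have hi := ih h.of_succ
    convert (h.of_succ.mul hi).mul hi.shift using 2 with m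
    have h₀ := (hs m).ne'
    have h₁ := (hs (m + 1)).ne'
    field_simp

end CompMonoUpTo

theorem CompMono.add {s t : ℕ → ℝ} (hs : CompMono s) (ht : CompMono t) :
    CompMono (fun m => s m + t m) :=
  compMono_iff.2 fun N => (compMono_iff.1 hs N).add (compMono_iff.1 ht N)

theorem CompMono.mul {s t : ℕ → ℝ} (hs : CompMono s) (ht : CompMono t) :
    CompMono (fun m => s m * t m) :=
  compMono_iff.2 fun N => (compMono_iff.1 hs N).mul (compMono_iff.1 ht N)

theorem CompMono.inv {s : ℕ → ℝ} (hs : ∀ m, 0 < s m)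
    (h : CompMono (fun m => s (m + 1) - s m)) : CompMono (fun m => (s m)⁻¹) :=
  compMono_iff.2 fun N => CompMonoUpTo.inv hs (compMono_iff.1 h N)

theorem compMono_const {t : ℝ} (ht : 0 ≤ t) : CompMono (fun _ => t) := by
  have h₀ : CompMono (fun _ => 0) := by
    refine compMono_iff.2 fun N => ?_
    induction N with
    | zero => exact fun _ => le_rfl
    | succ N ih => exact ⟨fun _ => le_rfl, by simpa using ih⟩
  refine compMono_iff.2 fun N => ?_
  cases N with
  | zero => exact fun _ => ht
  | succ N => exact ⟨fun _ => ht, by simpa using compMono_iff.1 h₀ N⟩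

theorem compMono_sum {ι : Type*} (S : Finset ι) {f : ι → ℕ → ℝ}
    (h : ∀ i ∈ S, CompMono (f i)) : CompMono (fun m => ∑ i ∈ S, f i m) := by
  classical
  induction S using Finset.induction_on with
  | empty => simpa using compMono_const le_rfl
  | insert i S hi ih =>
    simp only [Finset.sum_insert hi]
    exact (h i (by simp)).add (ih fun j hj => h j (by simp [hj]))

theorem compMono_prod {ι : Type*} (S : Finset ι) {f : ι → ℕ → ℝ}
    (h : ∀ i ∈ S, CompMono (f i)) : CompMono (fun m => ∏ i ∈ S, f i m) := by
  classical
  induction S using Finset.induction_on with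
  | empty => simpa using compMono_const zero_le_one
  | insert i S hi ih =>
    simp only [Finset.prod_insert hi]
    exact (h i (by simp)).mul (ih fun j hj => h j (by simp [hj]))

theorem compMono_inv_natCast_add {t : ℝ} (ht : 0 < t) :
    CompMono (fun m => ((m : ℝ) + t)⁻¹) := by
  refine CompMono.inv (fun m => by positivity) ?_
  convert compMono_const zero_le_one using 2 with m
  push_cast; ring

/-- Partial fraction decomposition of a quotient of products of interlacing linear factors. -/
theorem exists_prod_div_eq_one_sub_sum (k : ℕ) (A B : ℕ → ℝ)
    (hA : ∀ j, 1 ≤ j → j ≤ k → 0 < A j)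
    (hBA : ∀ j, 1 ≤ j → j ≤ k → B j ≤ A j)
    (hAB : ∀ j, 1 ≤ j → j < k → A j ≤ B (j + 1)) :
    ∃ d : ℕ → ℝ, (∀ j, 0 ≤ d j) ∧ ∀ x : ℝ, 0 ≤ x →
      ∏ j ∈ Finset.Icc 1 k, (x + B j) / (x + A j) =
        1 - ∑ j ∈ Finset.Icc 1 k, d j * (x + A j)⁻¹ := by
  induction k with
  | zero => exact ⟨0, fun _ => le_rfl, by simp⟩
  | succ k ih =>
    obtain ⟨d, hd, hprod⟩ := ih (fun j h₁ h₂ => hA j h₁ (by omega))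
      (fun j h₁ h₂ => hBA j h₁ (by omega)) (fun j h₁ h₂ => hAB j h₁ (by omega))
    have hle : ∀ i, ∀ j ≤ k, 1 ≤ j → j + i = k → A j ≤ B (k + 1) := by
      intro i
      induction i with
      | zero => intro j hj h₁ h; obtain rfl : j = k := h; exact hAB j h₁ (by omega)
      | succ i ih =>
        intro j hj h₁ h
        exact (hAB j h₁ (by omega)).trans
          ((hBA (j + 1) (by omega) (by omega)).trans (ih (j + 1) (by omega) (by omega) (by omega)))
    have hAk := hA (k + 1) (by omega) le_rfl
    rcases (hBA (k + 1) (by omega) le_rfl).eq_or_lt with heq | hlt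
    · refine ⟨fun j => if j = k + 1 then 0 else d j, fun j => ?_, fun x hx => ?_⟩
      · dsimp only; split_ifs
        exacts [le_rfl, hd j]
      · rw [Finset.prod_Icc_succ_top (by omega), Finset.sum_Icc_succ_top (by omega), hprod x hx,
          heq, div_self (by positivity)]
        simp only [if_true, zero_mul, add_zero, mul_one]
        congr 1
        refine Finset.sum_congr rfl fun j hj => ?_
        rw [if_neg (by simp only [Finset.mem_Icc] at hj; omega)]
    · have hbound : ∀ j ∈ Finset.Icc 1 k, A j ≤ B (k + 1) := fun j hj => by
        rw [Finset.mem_Icc] at hj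
        exact hle (k - j) j hj.2 hj.1 (by omega)
      refine ⟨fun j => if j = k + 1 then
          (A (k + 1) - B (k + 1)) * (1 + ∑ i ∈ Finset.Icc 1 k, d i / (A (k + 1) - A i))
        else if j ∈ Finset.Icc 1 k then d j * ((B (k + 1) - A j) / (A (k + 1) - A j)) else 0,
        fun j => ?_, fun x hx => ?_⟩
      · dsimp only
        split_ifs with h₁ h₂
        · refine mul_nonneg (by linarith) (add_nonneg zero_le_one (Finset.sum_nonneg fun i hi => ?_))
          exact div_nonneg (hd i) (by linarith [hbound i hi])
        · have := hbound j h₂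
          exact mul_nonneg (hd j) (div_nonneg (by linarith) (by linarith))
        · exact le_rfl
      · rw [Finset.prod_Icc_succ_top (by omega), Finset.sum_Icc_succ_top (by omega), hprod x hx]
        beta_reduce
        rw [if_pos rfl]
        have hxA : x + A (k + 1) ≠ 0 := by positivity
        have hterm : ∀ j ∈ Finset.Icc 1 k,
            (if j = k + 1 then
              (A (k + 1) - B (k + 1)) * (1 + ∑ i ∈ Finset.Icc 1 k, d i / (A (k + 1) - A i))
            else if j ∈ Finset.Icc 1 k then d j * ((B (k + 1) - A j) / (A (k + 1) - A j)) else 0) *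
              (x + A j)⁻¹ =
            d j * (x + A j)⁻¹ * ((x + B (k + 1)) / (x + A (k + 1))) -
              (A (k + 1) - B (k + 1)) * (x + A (k + 1))⁻¹ * (d j / (A (k + 1) - A j)) := by
          intro j hj
          have hj' := Finset.mem_Icc.1 hj
          rw [if_neg (by omega), if_pos hj]
          have h₁ : A (k + 1) - A j ≠ 0 := by have := hbound j hj; exact ne_of_gt (by linarith)
          have h₂ : x + A j ≠ 0 := by
            have := hA j hj'.1 (by omega)
            positivity
          field_simp
          ring
        rw [Finset.sum_congr rfl hterm, Finset.sum_sub_distrib, ← Finset.sum_mul, ← Finset.mul_sum]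
        field_simp
        ring

theorem d1_iterate_apply (f : ℕ → ℕ → ℝ) (k m n : ℕ) :
    d1^[k] f m n = dSeq^[k] (fun i => f i n) m := by
  induction k generalizing m with
  | zero => rfl
  | succ k ih => simp only [Function.iterate_succ_apply', d1, dSeq, ih]

theorem d2_iterate_mul_inv_add (u r : ℕ → ℝ) (hr : ∀ m, 0 < r m) (k m n : ℕ) :
    d2^[k] (fun m n => u m * (r m + n)⁻¹) m n =
      (-1) ^ k * (k.factorial * (u m * ∏ i ∈ Finset.range (k + 1), (r m + n + i)⁻¹)) := by
  induction k generalizing n with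
  | zero => simp
  | succ k ih =>
    rw [Function.iterate_succ_apply', d2, ih, ih, Finset.prod_range_succ' _ (k + 1),
      Finset.prod_range_succ _ k, Finset.prod_range_succ' _ k, Finset.prod_range_succ _ k]
    have h (i : ℕ) : r m + (n + 1 : ℕ) + i = r m + n + (i + 1 : ℕ) := by push_cast; ring
    simp only [h, Nat.factorial_succ]
    have hrm := hr m
    push_cast
    field_simp
    ring

theorem jointCompMono_mul_inv_add {u r : ℕ → ℝ} (hu : CompMono u) (hr : ∀ m, 0 < r m)
    (hdr : CompMono (fun m => r (m + 1) - r m)) :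
    JointCompMono (fun m n => u m * (r m + n)⁻¹) := by
  intro β₁ β₂ m n
  simp only [d1_iterate_apply, d2_iterate_mul_inv_add u r hr, dSeq_iterate_const_mul ((-1) ^ β₂)]
  rw [pow_add, mul_assoc, ← mul_assoc ((-1 : ℝ) ^ β₂), ← mul_pow, neg_one_mul, neg_neg, one_pow,
    one_mul]
  refine (compMono_const (Nat.cast_nonneg _)).mul (hu.mul (compMono_prod _ fun i _ => ?_)) β₁ m
  refine CompMono.inv (fun m => by have := hr m; positivity) ?_
  simpa only [add_sub_add_right_eq_sub] using hdr

theorem statement2 (k : ℕ) (hk : 0 < k) (a₀ b₀ : ℝ) (ha₀ : 0 < a₀) (hb₀ : 0 < b₀)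
    (A B : ℕ → ℝ)
    (hA : ∀ j, 1 ≤ j → j ≤ k → 0 < A j) (hB : ∀ j, 1 ≤ j → j ≤ k → 0 < B j)
    (c : ℕ → ℝ) (hc : ∀ m, 0 < c m)
    (hBA : ∀ j, 1 ≤ j → j ≤ k → B j ≤ A j)
    (hAB : ∀ j, 1 ≤ j → j < k → A j ≤ B (j + 1))
    (hca : CompMono (fun m => c m / (a₀ * ∏ j ∈ Finset.Icc 1 k, ((m : ℝ) + A j)))) :
    JointCompMono (fun m n =>
      c m / (b₀ * ∏ j ∈ Finset.Icc 1 k, ((m : ℝ) + B j) +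
        (a₀ * ∏ j ∈ Finset.Icc 1 k, ((m : ℝ) + A j)) * n)) := by
  obtain ⟨d, hd, hprod⟩ := exists_prod_div_eq_one_sub_sum k A B hA hBA hAB
  have hpos : ∀ C : ℕ → ℝ, (∀ j, 1 ≤ j → j ≤ k → 0 < C j) → ∀ m : ℕ,
      0 < ∏ j ∈ Finset.Icc 1 k, ((m : ℝ) + C j) := fun C hC m =>
    Finset.prod_pos fun j hj => by
      have := hC j (Finset.mem_Icc.1 hj).1 (Finset.mem_Icc.1 hj).2
      positivity
  let r : ℕ → ℝ := fun m => b₀ / a₀ * ∏ j ∈ Finset.Icc 1 k, ((m : ℝ) + B j) / ((m : ℝ) + A j)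
  have hr : ∀ m, 0 < r m := fun m => by
    simp only [r, Finset.prod_div_distrib]
    have := hpos A hA m
    have := hpos B hB m
    positivity
  have hdr : CompMono (fun m => r (m + 1) - r m) := by
    have hsum : CompMono (fun m => ∑ j ∈ Finset.Icc 1 k, d j * ((m : ℝ) + A j)⁻¹) :=
      compMono_sum _ fun j hj => (compMono_const (hd j)).mul
        (compMono_inv_natCast_add (hA j (Finset.mem_Icc.1 hj).1 (Finset.mem_Icc.1 hj).2))
    convert (compMono_const (div_pos hb₀ ha₀).le).mul hsum.sub_shift using 2 with m
    simp only [r, hprod _ (Nat.cast_nonneg _)]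
    ring
  convert jointCompMono_mul_inv_add hca hr hdr using 3 with m n
  simp only [r, Finset.prod_div_distrib]
  have := hpos A hA m
  have := hpos B hB m
  field_simp
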